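/- The graph B1 contains the wheel W_5 as an induced subgraph; consequently B1 is not 3-colourable and is not word-representable. -/

import Mathlib

/-- Two distinct letters `x` and `y` alternate in the word `w` if, after deleting all
letters other than `x` and `y` from `w`, no two consecutive letters of the resulting
word are equal (i.e. it reads `xyxy...` or `yxyx...`). -/
def Alternates {V : Type*} [DecidableEq V] (w : List V) (x y : V) : Prop :=
  List.Chain' (· ≠ ·) (w.filter fun z => z = x ∨ z = y)

/-- A finite simple graph `G = (V, E)` is word-representable if there is a word over the
alphabet `V` in which every element of `V` occurs at least once and such that, for all
distinct `x, y ∈ V`, the letters `x` and `y` alternate in the word iff `{x, y} ∈ E`. -/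
def WordRepresentable {V : Type*} [DecidableEq V] (G : SimpleGraph V) : Prop :=
  ∃ w : List V, (∀ v : V, v ∈ w) ∧
    ∀ x y : V, x ≠ y → (G.Adj x y ↔ Alternates w x y)

/-- The wheel graph `W_n` on `n + 1` vertices: a cycle on the `n` vertices `Sum.inl i`
(`i : Fin n`), together with one new hub vertex `Sum.inr ()` adjacent to all of them. -/
def wheelGraph (n : ℕ) : SimpleGraph (Fin n ⊕ Unit) :=
  SimpleGraph.fromRel fun a b =>
    match a, b with
    | Sum.inl i, Sum.inl j => ((i : ℕ) + 1) % n = (j : ℕ)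
    | Sum.inl _, Sum.inr _ => True
    | _, _ => False

/-- The simple graph on `V` whose edges are (the unordered versions of) the pairs
occurring in the list `l`. -/
def graphOfList {V : Type*} (l : List (V × V)) : SimpleGraph V :=
  SimpleGraph.fromRel fun a b => (a, b) ∈ l

def edgesB1 : List ((Fin 3 × Fin 3) × (Fin 3 × Fin 3)) :=
  [
    ((0, 0), (1, 0)), ((0, 0), (0, 1)), ((0, 1), (1, 1)), ((0, 1), (0, 2)), ((0, 2), (1, 2)),
    ((1, 0), (2, 0)), ((1, 1), (2, 1)), ((1, 1), (1, 2)), ((1, 2), (2, 2)), ((2, 0), (2, 1)),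
    ((2, 1), (2, 2)), ((0, 1), (1, 2)), ((1, 1), (2, 2)), ((0, 1), (1, 0)), ((0, 1), (2, 0)),
    ((1, 1), (2, 0))]

/-- The graph `B1` from the paper. -/
def graphB1 : SimpleGraph (Fin 3 × Fin 3) := graphOfList edgesB1

/-- Prefix-count condition: in every prefix, `x` leads `y` by zero or one. -/
def PrefLead {V : Type*} [DecidableEq V] (w : List V) (x y : V) : Prop :=
  ∀ n, (w.take n).count y ≤ (w.take n).count x ∧ (w.take n).count x ≤ (w.take n).count y + 1

theorem prefLead_cons {V : Type*} [DecidableEq V] (z : V) (w : List V) (x y : V) :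
    PrefLead (z :: w) x y ↔
      ∀ n, ((z :: w.take n).count y ≤ (z :: w.take n).count x ∧
        (z :: w.take n).count x ≤ (z :: w.take n).count y + 1) := by
  constructor
  · intro h n
    have := h (n + 1)
    simpa only [List.take_succ_cons] using this
  · intro h n
    cases n with
    | zero => simp
    | succ n => simpa only [List.take_succ_cons] using h n

theorem chain_iff_prefLead {V : Type*} [DecidableEq V] (w : List V) :
    ∀ x y : V, x ≠ y →
      (List.IsChain (· ≠ ·) (y :: w.filter fun z => z = x ∨ z = y) ↔ PrefLead w x y) := by
  induction w with
  | nil => intro x y _; simp [PrefLead]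
  | cons z w ih =>
    intro x y hxy
    rw [prefLead_cons]
    by_cases hx : z = x
    · subst hx
      have h2 := ih y z hxy.symm
      have e : (fun a => decide (a = y ∨ a = z)) = (fun a => decide (a = z ∨ a = y)) := by
        funext a; simp [or_comm]
      rw [e] at h2
      rw [List.filter_cons_of_pos (by simp), List.isChain_cons_cons, h2]
      constructor
      · rintro ⟨_, h⟩ n
        have := h n
        rw [List.count_cons_self, List.count_cons_of_ne hxy]
        omega
      · intro h
        refine ⟨hxy.symm, fun n => ?_⟩
        have := h n
        rw [List.count_cons_self, List.count_cons_of_ne hxy] at this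
        omega
    · by_cases hy : z = y
      · subst hy
        rw [List.filter_cons_of_pos (by simp), List.isChain_cons_cons]
        constructor
        · rintro ⟨h, _⟩
          exact absurd rfl h
        · intro h
          have := h 0
          simp [hx] at this
      · rw [List.filter_cons_of_neg (by simp [hx, hy]), ih x y hxy]
        simp only [List.count_cons_of_ne hx, List.count_cons_of_ne hy]
        rfl

theorem alternates_iff {V : Type*} [DecidableEq V] (w : List V) (x y : V) (hxy : x ≠ y) :
    Alternates w x y ↔ PrefLead w x y ∨ PrefLead w y x := by
  have h1 := chain_iff_prefLead w x y hxy
  have h2 := chain_iff_prefLead w y x hxy.symm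
  have e : (fun a => decide (a = y ∨ a = x)) = (fun a => decide (a = x ∨ a = y)) := by
    funext a; simp [or_comm]
  rw [e] at h2
  rw [← h1, ← h2]
  unfold Alternates
  have hm : ∀ a ∈ w.filter (fun z => decide (z = x ∨ z = y)), a = x ∨ a = y := by
    intro a ha
    simpa using (List.mem_filter.1 ha).2
  generalize w.filter (fun z => decide (z = x ∨ z = y)) = f at hm
  show List.IsChain _ f ↔ _
  cases f with
  | nil => simp
  | cons a l =>
    rw [List.isChain_cons_cons, List.isChain_cons_cons]
    rcases hm a (by simp) with rfl | rfl
    · simp [hxy.symm]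
    · simp [hxy]

/-- In a word-representable graph the neighbourhood of any vertex is a comparability graph. -/
theorem nbhd_comparability {V : Type*} [DecidableEq V] (w : List V) (h : V) :
    ∃ d : V → ℕ → ℤ, ∀ x y : V, x ≠ y → x ≠ h → y ≠ h → Alternates w x h → Alternates w y h →
      (Alternates w x y ↔ d x ≤ d y ∨ d y ≤ d x) := by
  have key : ∀ v : V, ∃ e : ℤ, (e = 0 ∨ e = 1) ∧ (v ≠ h → Alternates w v h → ∀ n,
      ((w.take n).count v : ℤ) - e ≤ (w.take n).count h ∧
      ((w.take n).count h : ℤ) ≤ ((w.take n).count v : ℤ) - e + 1) := by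
    intro v
    by_cases hv : PrefLead w v h
    · refine ⟨1, Or.inr rfl, fun _ _ n => ?_⟩
      have := hv n
      omega
    · refine ⟨0, Or.inl rfl, fun hne ha n => ?_⟩
      have := ((alternates_iff w v h hne).1 ha).resolve_left hv n
      omega
  choose e he hb using key
  refine ⟨fun v n => ((w.take n).count v : ℤ) - e v, ?_⟩
  intro x y hxy hx hy ax ay
  have bx := hb x hx ax
  have bY := hb y hy ay
  have main : ∀ x y : V, (∀ n,
      ((w.take n).count x : ℤ) - e x ≤ (w.take n).count h ∧
      ((w.take n).count h : ℤ) ≤ ((w.take n).count x : ℤ) - e x + 1) → (∀ n,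
      ((w.take n).count y : ℤ) - e y ≤ (w.take n).count h ∧
      ((w.take n).count h : ℤ) ≤ ((w.take n).count y : ℤ) - e y + 1) →
      (∀ n, ((w.take n).count x : ℤ) - e x ≤ ((w.take n).count y : ℤ) - e y) →
      PrefLead w x y ∨ PrefLead w y x := by
    intro x y bx bY hle
    have h0 := hle 0
    simp only [List.take_zero, List.count_nil] at h0
    have b0 := bx 0
    by_cases hc : e x = e y
    · right
      intro n
      have := hle n
      have := bx n
      have := bY n
      omega
    · left
      intro n
      have := hle n
      have := bx n
      have := bY n
      have := he x
      have := he y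
      omega
  rw [alternates_iff w x y hxy]
  constructor
  · rintro (H | H)
    · by_cases hc : e x = 1 ∧ e y = 0
      · left; intro n; have := H n; simp only; omega
      · right; intro n; have := H n; have := he x; have := he y; simp only; omega
    · by_cases hc : e y = 1 ∧ e x = 0
      · right; intro n; have := H n; simp only; omega
      · left; intro n; have := H n; have := he x; have := he y; simp only; omega
  · rintro (H | H)
    · exact main x y bx bY H
    · exact (main y x bY bx H).symm

instance decAdjB1 : DecidableRel graphB1.Adj := fun a b =>
  inferInstanceAs (Decidable (a ≠ b ∧ ((a, b) ∈ edgesB1 ∨ (b, a) ∈ edgesB1)))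

/-- The images of the wheel's vertices. -/
def wheelMap : Fin 5 ⊕ Unit → Fin 3 × Fin 3
  | Sum.inl i => ![(0, 1), (1, 2), (2, 2), (2, 1), (2, 0)] i
  | Sum.inr _ => (1, 1)

theorem wheelMap_inj : Function.Injective wheelMap := by
  unfold Function.Injective
  decide

theorem wheelMap_adj (a b : Fin 5 ⊕ Unit) :
    graphB1.Adj (wheelMap a) (wheelMap b) ↔ (wheelGraph 5).Adj a b := by
  rcases a with i | u <;> rcases b with j | v
  · simp only [wheelGraph, SimpleGraph.fromRel_adj]
    revert i j
    decide
  · simp only [wheelGraph, SimpleGraph.fromRel_adj]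
    revert i v
    decide
  · simp only [wheelGraph, SimpleGraph.fromRel_adj]
    revert u j
    decide
  · simp only [wheelGraph, SimpleGraph.fromRel_adj]
    revert u v
    decide

theorem graphB1_wheel5_not_colorable_not_wordRepresentable :
    Nonempty (wheelGraph 5 ↪g graphB1) ∧
      ¬ graphB1.Colorable 3 ∧ ¬ WordRepresentable graphB1 := by
  refine ⟨⟨⟨⟨wheelMap, wheelMap_inj⟩, ?_⟩⟩, ?_, ?_⟩
  · intro a b
    exact wheelMap_adj a b
  · rintro ⟨c⟩
    have h1 := c.valid (show graphB1.Adj (1, 1) (0, 1) by decide)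
    have h2 := c.valid (show graphB1.Adj (1, 1) (1, 2) by decide)
    have h3 := c.valid (show graphB1.Adj (1, 1) (2, 2) by decide)
    have h4 := c.valid (show graphB1.Adj (1, 1) (2, 1) by decide)
    have h5 := c.valid (show graphB1.Adj (1, 1) (2, 0) by decide)
    have g1 := c.valid (show graphB1.Adj (0, 1) (1, 2) by decide)
    have g2 := c.valid (show graphB1.Adj (1, 2) (2, 2) by decide)
    have g3 := c.valid (show graphB1.Adj (2, 2) (2, 1) by decide)
    have g4 := c.valid (show graphB1.Adj (2, 1) (2, 0) by decide)
    have g5 := c.valid (show graphB1.Adj (2, 0) (0, 1) by decide)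
    omega
  · rintro ⟨w, _, hw⟩
    obtain ⟨d, hd⟩ := nbhd_comparability w ((1, 1) : Fin 3 × Fin 3)
    have H : ∀ x y : Fin 3 × Fin 3, x ≠ y → graphB1.Adj x (1, 1) → graphB1.Adj y (1, 1) →
        (graphB1.Adj x y ↔ d x ≤ d y ∨ d y ≤ d x) := by
      intro x y hxy hx hy
      rw [hw x y hxy]
      exact hd x y hxy hx.ne hy.ne ((hw _ _ hx.ne).1 hx) ((hw _ _ hy.ne).1 hy)
    have g1 := (H (0, 1) (1, 2) (by decide) (by decide) (by decide)).1 (by decide)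
    have g2 := (H (1, 2) (2, 2) (by decide) (by decide) (by decide)).1 (by decide)
    have g3 := (H (2, 2) (2, 1) (by decide) (by decide) (by decide)).1 (by decide)
    have g4 := (H (2, 1) (2, 0) (by decide) (by decide) (by decide)).1 (by decide)
    have g5 := (H (2, 0) (0, 1) (by decide) (by decide) (by decide)).1 (by decide)
    have n1 := mt (H (0, 1) (2, 2) (by decide) (by decide) (by decide)).2 (by decide)
    have n2 := mt (H (1, 2) (2, 1) (by decide) (by decide) (by decide)).2 (by decide)
    have n3 := mt (H (2, 2) (2, 0) (by decide) (by decide) (by decide)).2 (by decide)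
    have n4 := mt (H (2, 1) (0, 1) (by decide) (by decide) (by decide)).2 (by decide)
    have n5 := mt (H (2, 0) (1, 2) (by decide) (by decide) (by decide)).2 (by decide)
    have alt : ∀ a b c : ℕ → ℤ, ¬ (a ≤ c ∨ c ≤ a) →
        ¬ (a ≤ b ∧ b ≤ c) ∧ ¬ (c ≤ b ∧ b ≤ a) := fun a b c h =>
      ⟨fun k => h (Or.inl (k.1.trans k.2)), fun k => h (Or.inr (k.1.trans k.2))⟩
    have m1 := alt _ (d (1, 2)) _ n1
    have m2 := alt _ (d (2, 2)) _ n2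
    have m3 := alt _ (d (2, 1)) _ n3
    have m4 := alt _ (d (2, 0)) _ n4
    have m5 := alt _ (d (0, 1)) _ n5
    clear n1 n2 n3 n4 n5 H hd hw alt
    grind
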